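/- Classification of non-equilibrium states: if x ∉ X_eq, then x belongs to at least one of the following two classes. Upward-repulsive class: there exists a cohesive set C and an index i* ∈ C such that {i*} = argmin_{j∈C} x_j (the minimum over C is uniquely attained at i*) and Σ_{j∈C, j≠i*} w_{i*j} > 1/2. Downward-repulsive class: there exists a maximal cohesive set M such that, letting Θ = argmax_{i∈M} x_i, no cohesive set contained in Θ ∪ (V\M) contains any element of Θ. -/

import Mathlib

open Finset Filter Topology

/-- `m` is a weighted median of the values `x` with respect to weights `w`. -/
def IsWeightedMedian {n : ℕ} (x w : Fin n → ℝ) (m : ℝ) : Prop :=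
  (∃ i, x i = m) ∧
  ∑ i ∈ univ.filter (fun i => x i < m), w i ≤ 1 / 2 ∧
  ∑ i ∈ univ.filter (fun i => m < x i), w i ≤ 1 / 2

/-- `W` is a row-stochastic matrix. -/
def RowStochastic {n : ℕ} (W : Matrix (Fin n) (Fin n) ℝ) : Prop :=
  (∀ i j, 0 ≤ W i j) ∧ ∀ i, ∑ j, W i j = 1

/-- `M` is a cohesive set of the influence network `G(W)`. -/
def Cohesive {n : ℕ} (W : Matrix (Fin n) (Fin n) ℝ) (M : Finset (Fin n)) : Prop :=
  ∀ i ∈ M, (1 : ℝ) / 2 ≤ ∑ j ∈ M, W i j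

/-- `M` is a maximal cohesive set of the influence network `G(W)`. -/
def MaxCohesive {n : ℕ} (W : Matrix (Fin n) (Fin n) ℝ) (M : Finset (Fin n)) : Prop :=
  Cohesive W M ∧ ∀ i ∉ M, ¬ ((1 : ℝ) / 2 < ∑ j ∈ M, W i j)

/-- `Med` is the weighted-median operator: `Med x i` is the weighted median of `x`
with respect to the `i`-th row of `W` that is closest to `x i`. -/
def IsMedSelection {n : ℕ} (W : Matrix (Fin n) (Fin n) ℝ)
    (Med : (Fin n → ℝ) → Fin n → ℝ) : Prop :=
  ∀ x i, IsWeightedMedian x (W i) (Med x i) ∧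
    ∀ m, IsWeightedMedian x (W i) m → |Med x i - x i| ≤ |m - x i|

/-- `φ` is the solution map of the ODE `ẋ = g(x)`: `φ x0` is the solution starting at `x0`. -/
def IsFlow {n : ℕ} (g : (Fin n → ℝ) → (Fin n → ℝ))
    (φ : (Fin n → ℝ) → ℝ → (Fin n → ℝ)) : Prop :=
  ∀ x, φ x 0 = x ∧ ∀ t : ℝ, HasDerivAt (φ x) (g (φ x t)) t

/-- `order^{≤ r}(x)`: indices whose value is among the `r` largest distinct values of `x`. -/
noncomputable def orderLe {n : ℕ} (x : Fin n → ℝ) (r : ℕ) : Finset (Fin n) :=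
  univ.filter (fun i => ((univ.image x).filter (fun v => x i < v)).card < r)

/-- The set of equilibria of the CTWM dynamics. -/
def Xeq {n : ℕ} (W : Matrix (Fin n) (Fin n) ℝ) : Set (Fin n → ℝ) :=
  {x | ∀ r : ℕ, 1 ≤ r → r ≤ (univ.image x).card → MaxCohesive W (orderLe x r)}

/-- The ω-limit set of a trajectory `φ`. -/
def omegaLimitSet {n : ℕ} (φ : ℝ → (Fin n → ℝ)) : Set (Fin n → ℝ) :=
  {z | ∃ u : ℕ → ℝ, Tendsto u atTop atTop ∧ Tendsto (fun k => φ (u k)) atTop (𝓝 z)}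

lemma lt_of_mem_orderLe {n : ℕ} {x : Fin n → ℝ} {r : ℕ} {i j : Fin n}
    (hi : i ∉ orderLe x r) (hj : j ∈ orderLe x r) : x i < x j := by
  by_contra! h
  simp only [orderLe, mem_filter, mem_univ, true_and, not_lt] at hi hj
  have hsub : (univ.image x).filter (fun v => x i < v) ⊆
      (univ.image x).filter (fun v => x j < v) :=
    monotone_filter_right _ fun v _ hv => h.trans_lt hv
  exact (hi.trans (card_le_card hsub)).not_gt hj

lemma RowStochastic.sum_le_sum_of_subset {n : ℕ} {W : Matrix (Fin n) (Fin n) ℝ}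
    (hW : RowStochastic W) {s t : Finset (Fin n)} (hst : s ⊆ t) (i : Fin n) :
    ∑ j ∈ s, W i j ≤ ∑ j ∈ t, W i j :=
  Finset.sum_le_sum_of_subset_of_nonneg hst fun j _ _ => hW.1 i j

/-- Adding a node that puts at least half of its weight on a cohesive set keeps it cohesive. -/
lemma Cohesive.insert {n : ℕ} {W : Matrix (Fin n) (Fin n) ℝ} (hW : RowStochastic W)
    {A : Finset (Fin n)} (hA : Cohesive W A) {i : Fin n} (hi : 1 / 2 ≤ ∑ j ∈ A, W i j) :
    Cohesive W (insert i A) := by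
  intro k hk
  refine le_trans ?_ (hW.sum_le_sum_of_subset (subset_insert i A) k)
  rcases mem_insert.mp hk with rfl | hk
  · exact hi
  · exact hA k hk

/-- Every set of nodes has a largest cohesive subset. -/
lemma exists_largest_cohesive_subset {n : ℕ} {W : Matrix (Fin n) (Fin n) ℝ}
    (hW : RowStochastic W) (U : Finset (Fin n)) :
    ∃ A ⊆ U, Cohesive W A ∧ ∀ C ⊆ U, Cohesive W C → C ⊆ A := by
  classical
  refine ⟨(U.powerset.filter (Cohesive W)).biUnion id, ?_, ?_, ?_⟩
  · exact biUnion_subset.mpr fun C hC => mem_powerset.mp (mem_filter.mp hC).1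
  · intro i hi
    obtain ⟨C, hC, hiC⟩ := mem_biUnion.mp hi
    exact ((mem_filter.mp hC).2 i hiC).trans
      (hW.sum_le_sum_of_subset (subset_biUnion_of_mem id hC) i)
  · exact fun C hCU hC =>
      subset_biUnion_of_mem id (mem_filter.mpr ⟨mem_powerset.mpr hCU, hC⟩)

/-- The complement of a maximal cohesive set is maximal cohesive. -/
lemma MaxCohesive.compl {n : ℕ} {W : Matrix (Fin n) (Fin n) ℝ} (hW : RowStochastic W)
    {A : Finset (Fin n)} (hA : MaxCohesive W A) : MaxCohesive W Aᶜ := by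
  have hsum (i : Fin n) : ∑ j ∈ A, W i j + ∑ j ∈ Aᶜ, W i j = 1 :=
    (sum_add_sum_compl A _).trans (hW.2 i)
  constructor
  · intro i hi
    linarith [hsum i, not_lt.mp (hA.2 i (mem_compl.mp hi))]
  · intro i hi
    linarith [hsum i, hA.1 i (by simpa using hi)]

/-- Classification of non-equilibrium states: every `x ∉ X_eq` is in the
upward-repulsive class or in the downward-repulsive class. -/
theorem non_equilibrium_classification {n : ℕ}
    (W : Matrix (Fin n) (Fin n) ℝ) (hW : RowStochastic W)
    (x : Fin n → ℝ) (hx : x ∉ Xeq W) :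
    (∃ C : Finset (Fin n), Cohesive W C ∧ ∃ istar ∈ C,
        (∀ j ∈ C, j ≠ istar → x istar < x j) ∧
        1 / 2 < ∑ j ∈ C.erase istar, W istar j) ∨
    (∃ M : Finset (Fin n), M.Nonempty ∧ MaxCohesive W M ∧
        ∀ C : Finset (Fin n), Cohesive W C →
          C ⊆ (M.filter (fun i => ∀ j ∈ M, x j ≤ x i)) ∪ Mᶜ →
          Disjoint C (M.filter (fun i => ∀ j ∈ M, x j ≤ x i))) := by
  by_contra! hcon
  obtain ⟨hup, hdown⟩ := hcon
  refine hx fun r _ _ => ?_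
  obtain ⟨A, hAU, hA, hmax⟩ := exists_largest_cohesive_subset hW (orderLe x r)
  have hAmax : MaxCohesive W A := by
    refine ⟨hA, fun i hi hlt => ?_⟩
    have hins := hA.insert hW hlt.le
    by_cases hiU : i ∈ orderLe x r
    · exact hi (hmax _ (insert_subset hiU hAU) hins (mem_insert_self i A))
    · refine (hup _ hins i (mem_insert_self i A) fun j hj hji => ?_).not_gt ?_
      · exact lt_of_mem_orderLe hiU (hAU (mem_of_mem_insert_of_ne hj hji))
      · rwa [erase_insert hi]
  suffices hUA : orderLe x r ⊆ A by rwa [← hAU.antisymm hUA]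
  intro i hiU
  by_contra hiA
  obtain ⟨C, hC, hsub, hnd⟩ := hdown Aᶜ ⟨i, mem_compl.mpr hiA⟩ (hAmax.compl hW)
  have hCU : C ⊆ orderLe x r := by
    intro k hk
    rcases mem_union.mp (hsub hk) with hk | hk
    · by_contra hkU
      exact ((mem_filter.mp hk).2 i (mem_compl.mpr hiA)).not_gt (lt_of_mem_orderLe hkU hiU)
    · exact hAU (by simpa using hk)
  refine hnd (disjoint_left.mpr fun k hk hkΘ => ?_)
  exact mem_compl.mp (mem_filter.mp hkΘ).1 (hmax C hCU hC hk)
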